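/- Let n > 3. The weighted orbit count of the ZMod 3 cyclic-shift action on the set of triples (a,b,c) of positive integers with a+b+c = n and gcd(a,b,c) = 1 (each orbit weighted by 1/(order of the stabilizer of any of its points)) equals φ(n)·ψ(n)/6 − φ(n)/2, where φ is Euler's totient function and ψ is the Dedekind psi function ψ(n) = n·∏_{p prime, p ∣ n} (1 + 1/p). -/

import Mathlib

/-- Triples of positive integers summing to `m` with `gcd = 1`, indexed by `ZMod 3`. -/
def PrimTriples (m : ℕ) : Type :=
  {v : ZMod 3 → ℕ // ((∀ i, 0 < v i) ∧ ∑ i, v i = m) ∧ Finset.univ.gcd v = 1}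

lemma gcd_shift (v : ZMod 3 → ℕ) (a : ZMod 3) :
    Finset.univ.gcd (fun i => v (i + a)) = Finset.univ.gcd v := by
  apply Nat.dvd_antisymm
  · refine Finset.dvd_gcd fun j _ => ?_
    simpa using Finset.gcd_dvd (f := fun i => v (i + a)) (Finset.mem_univ (j - a))
  · refine Finset.dvd_gcd fun j _ => ?_
    exact Finset.gcd_dvd (Finset.mem_univ (j + a))

/-- The action of `ZMod 3` (written multiplicatively) on primitive triples by cyclic
shifts. -/
instance primShiftAction (m : ℕ) :
    MulAction (Multiplicative (ZMod 3)) (PrimTriples m) where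
  smul g v := ⟨fun i => v.1 (i + g.toAdd),
    ⟨fun i => v.2.1.1 _,
      (Equiv.sum_comp (Equiv.addRight g.toAdd) v.1).trans v.2.1.2⟩,
    (gcd_shift v.1 g.toAdd).trans v.2.2⟩
  one_smul v := Subtype.ext <| funext fun i => by simp [HSMul.hSMul]
  mul_smul g h v := Subtype.ext <| funext fun i => by
    simp [HSMul.hSMul, add_comm, add_left_comm, add_assoc]

/-- The Dedekind psi function `ψ(n) = n·∏_{p ∣ n, p prime} (1 + 1/p)`, as a rational
number. -/
def dedekindPsi (n : ℕ) : ℚ :=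
  n * ∏ p ∈ n.primeFactors, (1 + 1 / (p : ℚ))

/-- Triples of positive integers summing to `n`. -/
def posTriples (n : ℕ) : Finset (ZMod 3 → ℕ) :=
  (Finset.univ.piAntidiag n).filter fun v => ∀ i, 0 < v i

lemma mem_posTriples {n : ℕ} {v : ZMod 3 → ℕ} :
    v ∈ posTriples n ↔ (∀ i, 0 < v i) ∧ ∑ i, v i = n := by
  simp [posTriples, and_comm]

lemma sum_zmod_three (v : ZMod 3 → ℕ) : ∑ i, v i = v 0 + v 1 + v 2 :=
  Fin.sum_univ_three v

lemma forall_zmod_three {P : ZMod 3 → Prop} : (∀ i, P i) ↔ P 0 ∧ P 1 ∧ P 2 :=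
  Fin.forall_fin_succ.trans <| and_congr_right fun _ => Fin.forall_fin_two

lemma card_posTriples (n : ℕ) : (posTriples n).card = ∑ i ∈ Finset.range (n - 1), i := by
  have h : (posTriples n).card =
      ((Finset.range (n - 1)).sigma fun i => Finset.range i).card := by
    refine Finset.card_nbij' (fun v => ⟨v 0 + v 1 - 1, v 0 - 1⟩)
      (fun x k => if k = 0 then x.2 + 1 else if k = 1 then x.1 - x.2 else n - 1 - x.1)
      ?_ ?_ ?_ ?_
    · intro v hv
      simp only [Finset.mem_coe, mem_posTriples, forall_zmod_three, sum_zmod_three] at hv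
      simp only [Finset.coe_sigma, Set.mem_sigma_iff, Finset.mem_coe, Finset.mem_range]
      omega
    · rintro ⟨i, j⟩ hx
      simp only [Finset.coe_sigma, Set.mem_sigma_iff, Finset.mem_coe, Finset.mem_range] at hx
      have h10 : (1 : ZMod 3) ≠ 0 := by decide
      have h20 : (2 : ZMod 3) ≠ 0 := by decide
      have h21 : (2 : ZMod 3) ≠ 1 := by decide
      simp only [Finset.mem_coe, mem_posTriples, forall_zmod_three, sum_zmod_three,
        if_true, h10, h20, h21, if_false]
      omega
    · intro v hv
      simp only [Finset.mem_coe, mem_posTriples, forall_zmod_three, sum_zmod_three] at hv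
      have h10 : (1 : ZMod 3) ≠ 0 := by decide
      have h20 : (2 : ZMod 3) ≠ 0 := by decide
      have h21 : (2 : ZMod 3) ≠ 1 := by decide
      refine funext (forall_zmod_three.2 ?_)
      simp only [if_true, h10, h20, h21, if_false]
      omega
    · rintro ⟨i, j⟩ hx
      simp only [Finset.coe_sigma, Set.mem_sigma_iff, Finset.mem_coe, Finset.mem_range] at hx
      have h10 : (1 : ZMod 3) ≠ 0 := by decide
      simp only [if_true, h10, if_false, Nat.add_sub_cancel]
      congr 1
      omega
  simp [h]

/-- The number of primitive triples summing to `n`. -/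
def primCount (n : ℕ) : ℕ :=
  ((posTriples n).filter fun v => Finset.univ.gcd v = 1).card

lemma card_filter_gcd_eq {n d : ℕ} (hd : d ∣ n) (hn : 0 < n) :
    ((posTriples n).filter fun v => Finset.univ.gcd v = d).card = primCount (n / d) := by
  obtain ⟨m, rfl⟩ := hd
  have hd : 0 < d := pos_of_mul_pos_left hn (Nat.zero_le m)
  rw [Nat.mul_div_cancel_left m hd]
  symm
  refine Finset.card_nbij (fun v i => d * v i) ?_ ?_ ?_
  · intro v hv
    simp only [Finset.coe_filter, Set.mem_ofPred_eq, mem_posTriples] at hv ⊢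
    exact ⟨⟨fun i => Nat.mul_pos hd (hv.1.1 i), by rw [← Finset.mul_sum, hv.1.2]⟩,
      by rw [Finset.gcd_mul_left, hv.2]; simp⟩
  · intro v _ w _ h
    exact funext fun i => Nat.eq_of_mul_eq_mul_left hd (congrFun h i)
  · intro w hw
    simp only [Finset.coe_filter, Set.mem_ofPred_eq, mem_posTriples] at hw
    obtain ⟨⟨hpos, hsum⟩, hgcd⟩ := hw
    have hdvd (i) : d ∣ w i := hgcd ▸ Finset.gcd_dvd (Finset.mem_univ i)
    choose v hv using hdvd
    obtain rfl : w = fun i => d * v i := funext hv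
    refine ⟨v, ?_, rfl⟩
    simp only [Finset.coe_filter, Set.mem_ofPred_eq, mem_posTriples]
    refine ⟨⟨fun i => Nat.pos_of_mul_pos_left (hpos i), ?_⟩, ?_⟩
    · rw [← Finset.mul_sum] at hsum
      exact Nat.eq_of_mul_eq_mul_left hd hsum
    · rw [Finset.gcd_mul_left] at hgcd
      exact Nat.eq_of_mul_eq_mul_left hd (by simpa using hgcd)

lemma sum_divisors_primCount {n : ℕ} (hn : 0 < n) :
    ∑ d ∈ n.divisors, primCount d = ∑ i ∈ Finset.range (n - 1), i := by
  rw [← card_posTriples, ← Nat.sum_div_divisors n,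
    Finset.card_eq_sum_card_fiberwise (f := fun v => Finset.univ.gcd v) (t := n.divisors)]
  · exact Finset.sum_congr rfl fun d hd =>
      (card_filter_gcd_eq (Nat.dvd_of_mem_divisors hd) hn).symm
  · intro v hv
    obtain ⟨-, hsum⟩ := mem_posTriples.1 hv
    simp only [Finset.mem_coe, Nat.mem_divisors]
    exact ⟨hsum ▸ Finset.dvd_sum fun i hi => Finset.gcd_dvd hi, hn.ne'⟩

lemma dedekindPsi_mul_of_coprime {m n : ℕ} (h : m.Coprime n) :
    dedekindPsi (m * n) = dedekindPsi m * dedekindPsi n := by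
  rw [dedekindPsi, h.primeFactors_mul, Finset.prod_union h.disjoint_primeFactors, dedekindPsi,
    dedekindPsi]
  push_cast
  ring

/-- The product of Euler's totient and the Dedekind psi function, which is Jordan's totient
`J₂`. -/
def totientMulPsi : ArithmeticFunction ℚ :=
  ⟨fun n => n.totient * dedekindPsi n, by simp⟩

lemma isMultiplicative_totientMulPsi : totientMulPsi.IsMultiplicative := by
  refine ArithmeticFunction.IsMultiplicative.iff_ne_zero.2
    ⟨by simp [totientMulPsi, dedekindPsi], fun {m n} _ _ h => ?_⟩
  simp only [totientMulPsi, ArithmeticFunction.coe_mk, dedekindPsi_mul_of_coprime h,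
    Nat.totient_mul h]
  push_cast
  ring

lemma totientMulPsi_prime_pow_succ {p : ℕ} (hp : p.Prime) (i : ℕ) :
    totientMulPsi (p ^ (i + 1)) = (p : ℚ) ^ (2 * (i + 1)) - (p : ℚ) ^ (2 * i) := by
  have hp0 : (p : ℚ) ≠ 0 := by exact_mod_cast hp.ne_zero
  simp only [totientMulPsi, ArithmeticFunction.coe_mk, dedekindPsi,
    Nat.totient_prime_pow_succ hp, Nat.primeFactors_prime_pow i.succ_ne_zero hp,
    Finset.prod_singleton]
  push_cast [hp.one_le]
  field_simp
  ring

lemma totientMulPsi_mul_zeta :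
    totientMulPsi * (ArithmeticFunction.zeta : ArithmeticFunction ℚ) =
      (ArithmeticFunction.pow 2 : ArithmeticFunction ℚ) := by
  refine (ArithmeticFunction.IsMultiplicative.eq_iff_eq_on_prime_powers _
    (isMultiplicative_totientMulPsi.mul ArithmeticFunction.isMultiplicative_zeta.natCast) _
    ArithmeticFunction.isMultiplicative_pow.natCast).2 fun p i hp => ?_
  rw [ArithmeticFunction.coe_mul_zeta_apply, Nat.sum_divisors_prime_pow hp,
    Finset.sum_range_succ']
  simp only [totientMulPsi_prime_pow_succ hp]
  rw [Finset.sum_range_sub fun i => (p : ℚ) ^ (2 * i), pow_zero p,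
    isMultiplicative_totientMulPsi.map_one]
  simp [ArithmeticFunction.pow_apply]
  ring

lemma sum_divisors_totientMulPsi {n : ℕ} : ∑ d ∈ n.divisors, totientMulPsi d = (n : ℚ) ^ 2 := by
  rw [← ArithmeticFunction.coe_mul_zeta_apply, totientMulPsi_mul_zeta]
  simp [ArithmeticFunction.pow_apply]

lemma two_mul_primCount {n : ℕ} (hn : 0 < n) :
    2 * (primCount n : ℚ) =
      totientMulPsi n - 3 * n.totient + 2 * if n = 1 then 1 else 0 := by
  have hT (m : ℕ) (hm : 0 < m) :
      ∑ d ∈ m.divisors, 2 * (primCount d : ℚ) = (m : ℚ) ^ 2 - 3 * m + 2 := by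
    obtain ⟨k, rfl⟩ := Nat.exists_eq_add_of_lt hm
    have h := sum_divisors_primCount hm
    have h2 := Finset.sum_range_id_mul_two (0 + k + 1 - 1)
    rw [← h] at h2
    rw [← Finset.mul_sum]
    rcases k with _ | k
    · have h1 : primCount 1 = 0 := by simpa using h
      norm_num [h1]
    · simp only [Nat.zero_add, Nat.add_sub_cancel] at h2 ⊢
      have h3 := congrArg (Nat.cast : ℕ → ℚ) h2
      push_cast at h3 ⊢
      linear_combination h3
  have hR (m : ℕ) (hm : 0 < m) :
      ∑ d ∈ m.divisors, (totientMulPsi d - 3 * d.totient + 2 * if d = 1 then 1 else 0) =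
        (m : ℚ) ^ 2 - 3 * m + 2 := by
    rw [Finset.sum_add_distrib, Finset.sum_sub_distrib, ← Finset.mul_sum, ← Finset.mul_sum,
      sum_divisors_totientMulPsi, ← Nat.cast_sum, Nat.sum_totient, Finset.sum_ite_eq']
    simp [hm.ne']
  rw [← ArithmeticFunction.sum_eq_iff_sum_mul_moebius_eq.1 hT n hn,
    ArithmeticFunction.sum_eq_iff_sum_mul_moebius_eq.1 hR n hn]

/-- Primitive triples as the elements of a finite set of functions. -/
def primTriplesEquiv (n : ℕ) : PrimTriples n ≃
    {v // v ∈ (posTriples n).filter fun v => Finset.univ.gcd v = 1} :=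
  Equiv.subtypeEquivRight fun v => by rw [Finset.mem_filter, mem_posTriples]

instance (n : ℕ) : Finite (PrimTriples n) := .of_equiv _ (primTriplesEquiv n).symm

lemma card_primTriples (n : ℕ) : Nat.card (PrimTriples n) = primCount n := by
  rw [Nat.card_congr (primTriplesEquiv n), Nat.card_eq_fintype_card, Fintype.card_coe, primCount]

/-- The orbit count weighted by inverse stabilizer orders is `|X| / |G|`. -/
lemma finsum_one_div_card_stabilizer (G X : Type*) [Group G] [Finite G] [Finite X]
    [MulAction G X] :
    ∑ᶠ ω : MulAction.orbitRel.Quotient G X,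
      (1 : ℚ) / Nat.card (MulAction.stabilizer G (Quotient.out ω)) =
      (Nat.card X : ℚ) / Nat.card G := by
  have := Fintype.ofFinite (MulAction.orbitRel.Quotient G X)
  rw [finsum_eq_sum_of_fintype,
    Nat.card_congr (MulAction.selfEquivSigmaOrbitsQuotientStabilizer G X), Nat.card_sigma,
    Nat.cast_sum, Finset.sum_div]
  refine Finset.sum_congr rfl fun ω _ => ?_
  rw [Subgroup.card_eq_card_quotient_mul_card_subgroup (MulAction.stabilizer G ω.out)]
  have hq : (Nat.card (G ⧸ MulAction.stabilizer G ω.out) : ℚ) ≠ 0 :=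
    Nat.cast_ne_zero.2 Nat.card_pos.ne'
  have hs : (Nat.card (MulAction.stabilizer G ω.out) : ℚ) ≠ 0 :=
    Nat.cast_ne_zero.2 Nat.card_pos.ne'
  push_cast
  field_simp

/-- The weighted orbit count of the cyclic shift action on primitive triples summing
to `n` equals `φ(n)ψ(n)/6 − φ(n)/2`. -/
theorem primitive_hexagon_count (n : ℕ) (hn : 3 < n) :
    ∑ᶠ ω : MulAction.orbitRel.Quotient (Multiplicative (ZMod 3)) (PrimTriples n),
      (1 : ℚ) / Nat.card (MulAction.stabilizer (Multiplicative (ZMod 3))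
        (Quotient.out ω)) =
      (Nat.totient n : ℚ) * dedekindPsi n / 6 - (Nat.totient n : ℚ) / 2 := by
  have h := two_mul_primCount (n := n) (by omega)
  have h1 : n ≠ 1 := by omega
  have hG : Nat.card (Multiplicative (ZMod 3)) = 3 := by simp
  rw [finsum_one_div_card_stabilizer, hG, card_primTriples]
  simp only [totientMulPsi, ArithmeticFunction.coe_mk, h1, if_false] at h
  push_cast
  linear_combination h / 6
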